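/- Let U ⊆ ℝⁿ be a bounded open set, let u be a convex function, continuous on the closure of U, and let μ be a Borel measure on U satisfying the doubling condition with doubling constant b. Suppose Mu(E) ≥ μ(E) for every Borel set E ⊆ U. Then there exists a constant C > 0, depending only on n and b, such that for every bounded convex set E ⊆ U and every affine function ℓ on ℝⁿ: μ(E)·|E| ≤ C·(sup_{x∈E} |u(x) − ℓ(x)|)ⁿ, where |E| is the Lebesgue measure of E. -/

import Mathlib

open MeasureTheory Set
open scoped RealInnerProductSpace ENNReal

noncomputable section

abbrev En (n : ℕ) := EuclideanSpace ℝ (Fin n)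

/-- The subgradient of `u` (as a convex function on `U`) at `x`. -/
def subgrad {n : ℕ} (U : Set (En n)) (u : En n → ℝ) (x : En n) : Set (En n) :=
  {p | ∀ y ∈ U, u x + ⟪p, y - x⟫ ≤ u y}

/-- The Monge–Ampère measure of `u` on a set `s`. -/
def MAm {n : ℕ} (U : Set (En n)) (u : En n → ℝ) (s : Set (En n)) : ℝ≥0∞ :=
  volume (⋃ x ∈ s, subgrad U u x)

/-- The centroid (center of mass with respect to Lebesgue measure) of a set. -/
def centroid {n : ℕ} (s : Set (En n)) : En n :=
  (volume s).toReal⁻¹ • ∫ x in s, x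

/-- A set function `ν` satisfies the doubling condition on `U` with constants `c, b`:
`ν(x_E + c(E − x_E)) ≥ b·ν(E)` for every bounded convex `E ⊆ U` with nonempty interior. -/
def DoublingWith {n : ℕ} (ν : Set (En n) → ℝ≥0∞) (U : Set (En n)) (c b : ℝ) : Prop :=
  ∀ s : Set (En n), s ⊆ U → Convex ℝ s → Bornology.IsBounded s → (interior s).Nonempty →
    ENNReal.ofReal b * ν s ≤ ν ((fun y => centroid s + c • (y - centroid s)) '' s)


/-- The cube of half-side `T` centered at the origin. -/
def cube (n : ℕ) (T : ℝ) : Set (En n) := {x | ∀ i, |x i| ≤ T}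

open scoped Pointwise in
theorem cube_eq_smul {n : ℕ} {T : ℝ} (hT : 0 < T) : cube n T = T • cube n 1 := by
  ext x
  rw [Set.mem_smul_set_iff_inv_smul_mem₀ hT.ne']
  simp only [cube, mem_ofPred_eq, PiLp.smul_apply, smul_eq_mul, abs_mul, abs_inv, abs_of_pos hT]
  refine forall_congr' fun i => ?_
  rw [inv_mul_le_iff₀ hT, mul_one]

theorem isBounded_cube (n : ℕ) (T : ℝ) : Bornology.IsBounded (cube n T) := by
  have h : cube n T ⊆ (EuclideanSpace.equiv (Fin n) ℝ) ⁻¹' (Metric.closedBall 0 |T|) := by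
    intro x hx
    rw [mem_preimage, mem_closedBall_zero_iff, pi_norm_le_iff_of_nonneg (abs_nonneg T)]
    exact fun i => (hx i).trans (le_abs_self T)
  exact (((EuclideanSpace.equiv (Fin n) ℝ).antilipschitz).isBounded_preimage
    Metric.isBounded_closedBall).subset h

/-- The volume of the cube of half-side `1`. -/
def cubeVol (n : ℕ) : ℝ := (volume (cube n 1)).toReal

open scoped Pointwise in
theorem volume_cube {n : ℕ} {T : ℝ} (hT : 0 < T) :
    volume (cube n T) = ENNReal.ofReal (T ^ n * cubeVol n) := by
  rw [cube_eq_smul hT, Measure.addHaar_smul_of_nonneg volume hT.le, finrank_euclideanSpace_fin,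
    ENNReal.ofReal_mul (by positivity), cubeVol,
    ENNReal.ofReal_toReal (isBounded_cube n 1).measure_lt_top.ne]

theorem cubeVol_nonneg (n : ℕ) : 0 ≤ cubeVol n := ENNReal.toReal_nonneg

/-- The matrix whose rows are the given vectors. -/
def rowMatrix {n : ℕ} (q : Fin n → En n) : Matrix (Fin n) (Fin n) ℝ :=
  Matrix.of fun i j => q i j

theorem det_toEuclideanLin {n : ℕ} (A : Matrix (Fin n) (Fin n) ℝ) :
    LinearMap.det (Matrix.toEuclideanLin A) = A.det := by
  rw [Matrix.toEuclideanLin_eq_toLin_orthonormal, LinearMap.det_toLin]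

theorem toEuclideanLin_rowMatrix_apply {n : ℕ} (q : Fin n → En n) (z : En n) (i : Fin n) :
    Matrix.toEuclideanLin (rowMatrix q) z i = ⟪q i, z⟫ := by
  rw [Matrix.toLpLin_apply]
  simp [rowMatrix, Matrix.mulVec, dotProduct, PiLp.inner_apply, mul_comm]

theorem volume_slab {n : ℕ} (q : Fin n → En n) (hq : (rowMatrix q).det ≠ 0) (x₀ : En n) {T : ℝ}
    (hT : 0 < T) :
    volume {z : En n | ∀ i, |⟪q i, z - x₀⟫| ≤ T} =
      ENNReal.ofReal (|(rowMatrix q).det|⁻¹ * (T ^ n * cubeVol n)) := by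
  have h : {z : En n | ∀ i, |⟪q i, z - x₀⟫| ≤ T} =
      (fun z => z + -x₀) ⁻¹' (Matrix.toEuclideanLin (rowMatrix q) ⁻¹' cube n T) := by
    ext z
    simp only [mem_ofPred_eq, mem_preimage, cube, toEuclideanLin_rowMatrix_apply,
      ← sub_eq_add_neg]
  rw [h, measure_preimage_add_right, Measure.addHaar_preimage_linearMap volume
    (by rwa [det_toEuclideanLin]), det_toEuclideanLin, volume_cube hT,
    ← ENNReal.ofReal_mul (abs_nonneg _), abs_inv]

/-- A set whose vectors, put in place of any row of `q`, at most double the determinant has volume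
controlled by that determinant. -/
theorem volume_le_of_det_update_le {n : ℕ} (q : Fin n → En n) (hq : (rowMatrix q).det ≠ 0)
    (P : Set (En n))
    (hP : ∀ p ∈ P, ∀ i, |(rowMatrix (Function.update q i p)).det| ≤ 2 * |(rowMatrix q).det|) :
    volume P ≤ ENNReal.ofReal (|(rowMatrix q).det| * (2 ^ n * cubeVol n)) := by
  have hsub : P ⊆ Matrix.toEuclideanLin (rowMatrix q).transpose '' cube n 2 := by
    intro p hp
    refine ⟨(rowMatrix q).det⁻¹ • WithLp.toLp 2 ((rowMatrix q).transpose.cramer p), ?_, ?_⟩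
    · intro i
      have hupd : (rowMatrix q).updateRow i p = rowMatrix (Function.update q i p) := by
        ext j k
        by_cases hj : j = i
        · subst hj; simp [rowMatrix]
        · simp [rowMatrix, hj]
      have := hP p hp i
      rw [PiLp.smul_apply, PiLp.toLp_apply, Matrix.cramer_transpose_apply, hupd, smul_eq_mul,
        abs_mul, abs_inv, inv_mul_le_iff₀ (abs_pos.2 hq)]
      linarith
    · rw [map_smul, Matrix.toLpLin_apply, Matrix.mulVec_cramer, Matrix.det_transpose,
        WithLp.toLp_smul, inv_smul_smul₀ hq]
  refine (measure_mono hsub).trans ?_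
  rw [Measure.addHaar_image_linearMap, det_toEuclideanLin, Matrix.det_transpose,
    volume_cube two_pos, ← ENNReal.ofReal_mul (abs_nonneg _)]

theorem volume_eq_zero_of_det_eq_zero {n : ℕ} (P : Set (En n))
    (hP : ∀ q : Fin n → En n, (∀ i, q i ∈ P) → (rowMatrix q).det = 0) : volume P = 0 := by
  by_cases hs : Submodule.span ℝ P = ⊤
  · exfalso
    let B := Module.Basis.ofSpan hs.ge
    let e := B.indexEquiv (EuclideanSpace.basisFun (Fin n) ℝ).toBasis
    let B' := B.reindex e
    have hmem : ∀ i, B' i ∈ P := fun i => by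
      rw [Module.Basis.reindex_apply]
      exact Module.Basis.ofSpan_subset hs.ge (mem_range_self _)
    have hli : LinearIndependent ℝ (rowMatrix B').row :=
      B'.linearIndependent.map' (EuclideanSpace.equiv (Fin n) ℝ).toLinearMap
        (LinearEquiv.ker (EuclideanSpace.equiv (Fin n) ℝ).toLinearEquiv)
    rw [Matrix.linearIndependent_rows_iff_isUnit, Matrix.isUnit_iff_isUnit_det] at hli
    exact hli.ne_zero (hP B' hmem)
  · exact measure_mono_null Submodule.subset_span (Measure.addHaar_submodule volume _ hs)

/-- If linear functionals in `P` have small mean absolute value on `K`, the product of the volumes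
of `P` and `K` is controlled. -/
theorem volume_mul_volume_le {n : ℕ} (K P : Set (En n)) (hK : volume K ≠ ∞) (x₀ : En n)
    {r : ℝ} (hr : 0 < r)
    (hP : ∀ q ∈ P, ∫⁻ z in K, ENNReal.ofReal |⟪q, z - x₀⟫| ≤ ENNReal.ofReal (2 * r) * volume K) :
    volume P * volume K ≤
      ENNReal.ofReal (2 ^ (n + 1) * (4 * (n + 1)) ^ n * cubeVol n ^ 2 * r ^ n) := by
  have hv := cubeVol_nonneg n
  have hKr : volume K = ENNReal.ofReal (volume K).toReal := (ENNReal.ofReal_toReal hK).symm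
  have key : ∀ q : Fin n → En n, (∀ i, q i ∈ P) →
      |(rowMatrix q).det| * (volume K).toReal ≤ 2 * ((4 * (n + 1) * r) ^ n * cubeVol n) := by
    intro q hqP
    by_cases hq : (rowMatrix q).det = 0
    · rw [hq, abs_zero, zero_mul]; positivity
    have hT : 0 < 4 * ((n : ℝ) + 1) * r := by positivity
    set T := 4 * ((n : ℝ) + 1) * r with hTdef
    have hmeas : ∀ i, Measurable fun z : En n => ENNReal.ofReal |⟪q i, z - x₀⟫| := fun i => by
      fun_prop
    have hsum : ENNReal.ofReal T * (volume.restrict K)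
        {z | ENNReal.ofReal T ≤ ∑ i, ENNReal.ofReal |⟪q i, z - x₀⟫|} ≤
        n * (ENNReal.ofReal (2 * r) * volume K) := by
      refine (mul_meas_ge_le_lintegral (Finset.measurable_sum _ fun i _ => hmeas i) _).trans ?_
      rw [lintegral_finsetSum _ fun i _ => hmeas i]
      refine (Finset.sum_le_sum fun i _ => hP (q i) (hqP i)).trans ?_
      simp
    have hcover : volume K ≤ (volume.restrict K)
        {z | ENNReal.ofReal T ≤ ∑ i, ENNReal.ofReal |⟪q i, z - x₀⟫|} +
        volume {z : En n | ∀ i, |⟪q i, z - x₀⟫| ≤ T} := by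
      rw [← Measure.restrict_apply_univ K]
      refine (measure_mono (t := {z | ENNReal.ofReal T ≤ ∑ i, ENNReal.ofReal |⟪q i, z - x₀⟫|} ∪
        {z : En n | ∀ i, |⟪q i, z - x₀⟫| ≤ T}) ?_).trans
        ((measure_union_le _ _).trans (add_le_add le_rfl (Measure.restrict_le_self _)))
      intro z _
      by_cases hz : ∀ i, |⟪q i, z - x₀⟫| ≤ T
      · exact Or.inr hz
      · push Not at hz
        obtain ⟨i, hi⟩ := hz
        refine Or.inl ((ENNReal.ofReal_le_ofReal hi.le).trans ?_)
        exact Finset.single_le_sum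
          (f := fun i => ENNReal.ofReal |⟪q i, z - x₀⟫|) (fun _ _ => zero_le) (Finset.mem_univ i)
    rw [volume_slab q hq x₀ hT] at hcover
    set m := (volume.restrict K) {z | ENNReal.ofReal T ≤ ∑ i, ENNReal.ofReal |⟪q i, z - x₀⟫|}
    have hm : m ≠ ∞ := ((measure_mono (subset_univ _)).trans_lt
      (by rw [Measure.restrict_apply_univ]; exact hK.lt_top)).ne
    have h1 := ENNReal.toReal_mono
      (ENNReal.mul_ne_top (ENNReal.natCast_ne_top n)
        (ENNReal.mul_ne_top ENNReal.ofReal_ne_top hK)) hsum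
    have h2 := ENNReal.toReal_mono (ENNReal.add_ne_top.2 ⟨hm, ENNReal.ofReal_ne_top⟩) hcover
    rw [ENNReal.toReal_add hm ENNReal.ofReal_ne_top, ENNReal.toReal_ofReal (by positivity)] at h2
    simp only [ENNReal.toReal_mul, ENNReal.toReal_natCast] at h1
    rw [ENNReal.toReal_ofReal hT.le, ENNReal.toReal_ofReal (by positivity)] at h1
    have hdet := abs_pos.2 hq
    have h3 : m.toReal ≤ (volume K).toReal / 2 := by
      have : T * m.toReal ≤ T * ((volume K).toReal / 2) := by
        refine h1.trans ?_
        have : 0 ≤ r * (volume K).toReal := by positivity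
        rw [hTdef]; nlinarith
      exact le_of_mul_le_mul_left this hT
    have h4 : (volume K).toReal ≤
        2 * (|(rowMatrix q).det|⁻¹ * (T ^ n * cubeVol n)) := by linarith
    calc _ ≤ |(rowMatrix q).det| * (2 * (|(rowMatrix q).det|⁻¹ * (T ^ n * cubeVol n))) := by gcongr
      _ = _ := by field_simp
  by_cases hK0 : volume K = 0
  · simp [hK0]
  have hKpos : 0 < (volume K).toReal := ENNReal.toReal_pos hK0 hK
  by_cases hdeg : ∀ q : Fin n → En n, (∀ i, q i ∈ P) → (rowMatrix q).det = 0
  · simp [volume_eq_zero_of_det_eq_zero P hdeg]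
  push Not at hdeg
  obtain ⟨q₀, hq₀P, hq₀⟩ := hdeg
  let S : Set ℝ := {d | ∃ q : Fin n → En n, (∀ i, q i ∈ P) ∧ d = |(rowMatrix q).det|}
  have hS : BddAbove S := by
    refine ⟨2 * ((4 * (n + 1) * r) ^ n * cubeVol n) / (volume K).toReal, ?_⟩
    rintro _ ⟨q, hq, rfl⟩
    rw [le_div_iff₀ hKpos]
    exact key q hq
  have hs : 0 < sSup S := (abs_pos.2 hq₀).trans_le (le_csSup hS ⟨q₀, hq₀P, rfl⟩)
  obtain ⟨_, ⟨q, hqP, rfl⟩, hlt⟩ :=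
    exists_lt_of_lt_csSup (s := S) ⟨_, q₀, hq₀P, rfl⟩ (half_lt_self hs)
  have hdet : 0 < |(rowMatrix q).det| := (half_pos hs).trans hlt
  have hvol := volume_le_of_det_update_le q (abs_pos.1 hdet) P fun p hp i => by
    have : |(rowMatrix (Function.update q i p)).det| ≤ sSup S := by
      refine le_csSup hS ⟨_, fun j => ?_, rfl⟩
      by_cases hj : j = i
      · subst hj; simpa using hp
      · simpa [hj] using hqP j
    linarith
  refine (mul_le_mul_left hvol _).trans ?_
  rw [hKr, ← ENNReal.ofReal_mul (by positivity)]
  refine ENNReal.ofReal_le_ofReal ?_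
  have := mul_le_mul_of_nonneg_left (key q hqP) (show 0 ≤ 2 ^ n * cubeVol n by positivity)
  calc _ = 2 ^ n * cubeVol n * (|(rowMatrix q).det| * (volume K).toReal) := by ring
    _ ≤ _ := this
    _ = _ := by rw [mul_pow]; ring

theorem integrableOn_sub_of_isBounded {n : ℕ} {s : Set (En n)} (hs : Bornology.IsBounded s)
    (x₀ : En n) : IntegrableOn (fun x => x - x₀) s :=
  ((by fun_prop : Continuous fun x : En n => x - x₀).continuousOn.integrableOn_compact
    hs.isCompact_closure).mono_set subset_closure

theorem integral_sub_centroid {n : ℕ} {s : Set (En n)} (hs : Bornology.IsBounded s)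
    (h0 : volume s ≠ 0) : ∫ x in s, (x - centroid s) = 0 := by
  have hfin : volume s ≠ ∞ := hs.measure_lt_top.ne
  have hid : IntegrableOn (fun x : En n => x) s := by
    simpa using integrableOn_sub_of_isBounded hs 0
  rw [integral_sub hid (integrableOn_const hfin), setIntegral_const,
    centroid, Measure.real, smul_inv_smul₀ (ENNReal.toReal_pos h0 hfin).ne', sub_self]

theorem centroid_mem_interior {n : ℕ} {s : Set (En n)} (hc : Convex ℝ s)
    (hs : Bornology.IsBounded s) (h0 : volume s ≠ 0) : centroid s ∈ interior s := by
  by_contra hmem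
  obtain ⟨f, hf⟩ := geometric_hahn_banach_open_point hc.interior isOpen_interior hmem
  have hae : interior s =ᵐ[volume] s :=
    interior_ae_eq_of_null_frontier (hc.addHaar_frontier volume)
  have hint : IntegrableOn (fun x => x - centroid s) s :=
    integrableOn_sub_of_isBounded hs _
  have hzero : ∫ x in interior s, -f (x - centroid s) = 0 := by
    rw [setIntegral_congr_set hae, integral_neg, ContinuousLinearMap.integral_comp_comm f hint,
      integral_sub_centroid hs h0, map_zero, neg_zero]
  have hpos : ∀ x ∈ interior s, 0 < -f (x - centroid s) := fun x hx => by
    rw [map_sub]; linarith [hf x hx]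
  refine (?_ : 0 < ∫ x in interior s, -f (x - centroid s)).ne' hzero
  rw [setIntegral_pos_iff_support_of_nonneg_ae
    ((ae_restrict_mem isOpen_interior.measurableSet).mono fun x hx => (hpos x hx).le)
    ((f.integrable_comp (hint.mono_set interior_subset)).neg)]
  have hsupp : interior s ⊆ Function.support fun x => -f (x - centroid s) :=
    fun x hx => (hpos x hx).ne'
  rw [inter_eq_self_of_subset_right hsupp, measure_congr hae]
  exact pos_iff_ne_zero.2 h0

/-- A linear functional with mean zero about `x₀` that is at most `r` on `K` has mean absolute
value at most `2 * r`. -/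
theorem lintegral_abs_inner_le {n : ℕ} {K : Set (En n)} (hK : MeasurableSet K)
    (hb : Bornology.IsBounded K) {x₀ : En n} (hx₀ : ∫ x in K, (x - x₀) = 0) {q : En n} {r : ℝ}
    (hr : 0 ≤ r) (hq : ∀ z ∈ K, ⟪q, z - x₀⟫ ≤ r) :
    ∫⁻ z in K, ENNReal.ofReal |⟪q, z - x₀⟫| ≤ ENNReal.ofReal (2 * r) * volume K := by
  have hfin : volume K ≠ ∞ := hb.measure_lt_top.ne
  have hint : IntegrableOn (fun x => x - x₀) K :=
    integrableOn_sub_of_isBounded hb _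
  have hinner : IntegrableOn (fun x => ⟪q, x - x₀⟫) K := hint.const_inner q
  have hle : ∫ z in K, |⟪q, z - x₀⟫| ≤ ∫ z in K, (2 * r - ⟪q, z - x₀⟫) := by
    refine setIntegral_mono_on hinner.abs ((integrableOn_const hfin).sub hinner) hK fun z hz => ?_
    have := hq z hz
    rw [abs_le']
    constructor <;> linarith
  rw [integral_sub (integrable_const_iff.2 (Or.inr ⟨by simpa using hb.measure_lt_top⟩)) hinner,
    integral_inner hint, hx₀, inner_zero_right,
    sub_zero, setIntegral_const, smul_eq_mul, Measure.real] at hle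
  rw [← ofReal_integral_eq_lintegral_ofReal hinner.abs (ae_of_all _ fun _ => abs_nonneg _)]
  refine (ENNReal.ofReal_le_ofReal hle).trans ?_
  rw [ENNReal.ofReal_mul ENNReal.toReal_nonneg, ENNReal.ofReal_toReal hfin, mul_comm]

/-- Subgradients of `u` over the closed copy of a convex set `E`, contracted about an interior
point, lie in a translate of a polar set when `u` is close to an affine function on `E`. -/
theorem inner_sub_le_of_mem_subgrad {n : ℕ} {U E : Set (En n)} {u : En n → ℝ} {g x₀ w z p : En n}
    {c a M : ℝ} (hc : c ∈ Ioo (0 : ℝ) 1) (hEU : E ⊆ U) (hE : Convex ℝ E)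
    (hM : ∀ y ∈ E, |u y - (⟪g, y⟫ + a)| ≤ M) (hx₀ : x₀ ∈ interior E) (hw : w ∈ closure E)
    (hz : z ∈ interior E) (hp : p ∈ subgrad U u (x₀ + c • (w - x₀))) :
    (1 - c) * ⟪p - g, z - x₀⟫ ≤ 2 * M := by
  have hc' : 0 < 1 - c := sub_pos.2 hc.2
  have hmem : ∀ v ∈ interior E, (1 - c) • v + c • w ∈ E := fun v hv =>
    interior_subset (hE.combo_interior_closure_mem_interior hv hw hc' hc.1.le (by ring))
  have hx : x₀ + c • (w - x₀) = (1 - c) • x₀ + c • w := by module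
  rw [hx] at hp
  have h1 := abs_le.1 (hM _ (hmem x₀ hx₀))
  have h2 := abs_le.1 (hM _ (hmem z hz))
  have h3 := hp _ (hEU (hmem z hz))
  have h4 : (1 - c) • z + c • w - ((1 - c) • x₀ + c • w) = (1 - c) • (z - x₀) := by module
  rw [h4, inner_smul_right] at h3
  simp only [inner_add_right, inner_smul_right] at h1 h2
  rw [inner_sub_left, inner_sub_right g]
  linarith [h1.1, h2.2]

theorem exists_inner_add_const {n : ℕ} (ℓ : En n →ᵃ[ℝ] ℝ) :
    ∃ (g : En n) (a : ℝ), ∀ y, ℓ y = ⟪g, y⟫ + a := by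
  refine ⟨(InnerProductSpace.toDual ℝ (En n)).symm (LinearMap.toContinuousLinearMap ℓ.linear), ℓ 0,
    fun y => ?_⟩
  rw [InnerProductSpace.toDual_symm_apply, LinearMap.coe_toContinuousLinearMap']
  simpa using congrFun ℓ.decomp y

theorem MAm_mul_volume_le {n : ℕ} {U E : Set (En n)} {u : En n → ℝ} {g : En n} {c a M r : ℝ}
    (hc : c ∈ Ioo (0 : ℝ) 1) (hEU : E ⊆ U) (hE : Convex ℝ E) (hb : Bornology.IsBounded E)
    (h0 : volume E ≠ 0) (hM : ∀ y ∈ E, |u y - (⟪g, y⟫ + a)| ≤ M) (hr : 0 < r)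
    (hMr : 2 * M / (1 - c) ≤ r) :
    MAm U u ((fun y => centroid E + c • (y - centroid E)) '' closure E) * volume E ≤
      ENNReal.ofReal (2 ^ (n + 1) * (4 * (n + 1)) ^ n * cubeVol n ^ 2 * r ^ n) := by
  have hae : interior E =ᵐ[volume] E :=
    interior_ae_eq_of_null_frontier (hE.addHaar_frontier volume)
  have hzero : ∫ x in interior E, (x - centroid E) = 0 := by
    rw [setIntegral_congr_set hae, integral_sub_centroid hb h0]
  let P : Set (En n) := {q | ∀ z ∈ interior E, ⟪q, z - centroid E⟫ ≤ r}
  have hsub : (⋃ x ∈ (fun y => centroid E + c • (y - centroid E)) '' closure E, subgrad U u x) ⊆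
      (fun p => p + -g) ⁻¹' P := by
    intro p hp
    simp only [mem_iUnion, exists_prop] at hp
    obtain ⟨_, ⟨w, hw, rfl⟩, hp⟩ := hp
    intro z hz
    have h := inner_sub_le_of_mem_subgrad hc hEU hE hM (centroid_mem_interior hE hb h0) hw hz hp
    change ⟪p + -g, z - centroid E⟫ ≤ r
    rw [← sub_eq_add_neg]
    refine le_trans ?_ hMr
    rw [le_div_iff₀ (sub_pos.2 hc.2), mul_comm]
    exact h
  have hP : volume P * volume (interior E) ≤ _ :=
    volume_mul_volume_le (interior E) P (hb.subset interior_subset).measure_lt_top.ne (centroid E)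
      hr fun q hq => lintegral_abs_inner_le isOpen_interior.measurableSet
        (hb.subset interior_subset) hzero hr.le hq
  rw [measure_congr hae] at hP
  refine le_trans (mul_le_mul_left ?_ _) hP
  rw [← measure_preimage_add_right volume (-g) P]
  exact measure_mono hsub

/-- Lemma 2.11 (Lemma `lem:size section 3`): if `Mu ≥ μ` and `μ` is doubling, then
`μ(E)·|E| ≤ C·(sup_E |u − ℓ|)ⁿ` for every convex `E ⊆ U` and every affine `ℓ`,
with `C` depending only on `n` and the doubling constants. -/
theorem statement_11 (n : ℕ) (c b : ℝ) (hc : c ∈ Set.Ioo (0 : ℝ) 1) (hb : 0 < b) :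
    ∃ C : ℝ, 0 < C ∧
      ∀ (U : Set (En n)) (u : En n → ℝ) (μ : Measure (En n)),
        IsOpen U → Bornology.IsBounded U →
        ConvexOn ℝ (closure U) u → ContinuousOn u (closure U) →
        DoublingWith (fun s => μ s) U c b →
        (∀ s : Set (En n), s ⊆ U → MeasurableSet s → μ s ≤ MAm U u s) →
        ∀ E : Set (En n), E ⊆ U → Convex ℝ E → Bornology.IsBounded E →
          ∀ ℓ : En n →ᵃ[ℝ] ℝ,
            μ E * volume E ≤
              ENNReal.ofReal (C * (sSup ((fun x => |u x - ℓ x|) '' E)) ^ n) := by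
  have hc' : 0 < 1 - c := sub_pos.2 hc.2
  have hv := cubeVol_nonneg n
  set D : ℝ := 2 ^ (n + 1) * (4 * (n + 1)) ^ n * cubeVol n ^ 2
  have hD0 : 0 ≤ D := by positivity
  refine ⟨b⁻¹ * D * (2 / (1 - c)) ^ n + 1, by positivity, ?_⟩
  intro U u μ _ hUb _ hu hdoub hMA E hEU hE hEb ℓ
  by_cases h0 : volume E = 0
  · simp [h0]
  obtain ⟨g, a, hℓ⟩ := exists_inner_add_const ℓ
  set M := sSup ((fun x => |u x - ℓ x|) '' E)
  have hcont : ContinuousOn (fun x => |u x - ℓ x|) (closure U) :=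
    (hu.sub ℓ.continuous_of_finiteDimensional.continuousOn).abs
  have hbdd : BddAbove ((fun x => |u x - ℓ x|) '' E) :=
    (hUb.isCompact_closure.image_of_continuousOn hcont).bddAbove.mono
      (image_mono (hEU.trans subset_closure))
  have hM : ∀ y ∈ E, |u y - (⟪g, y⟫ + a)| ≤ M := fun y hy => by
    rw [← hℓ]
    exact le_csSup hbdd ⟨y, hy, rfl⟩
  have hM0 : 0 ≤ M := Real.sSup_nonneg (by rintro _ ⟨x, -, rfl⟩; exact abs_nonneg _)
  have hcen := centroid_mem_interior hE hEb h0
  set F := (fun y => centroid E + c • (y - centroid E)) '' closure E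
  have hFE : F ⊆ E := by
    rintro _ ⟨w, hw, rfl⟩
    have h := hE.combo_interior_closure_mem_interior hcen hw hc' hc.1.le (by ring)
    have heq : centroid E + c • (w - centroid E) = (1 - c) • centroid E + c • w := by module
    simpa only [heq] using interior_subset h
  have hFmeas : MeasurableSet F :=
    (hEb.isCompact_closure.image (by fun_prop)).isClosed.measurableSet
  have hμ : ENNReal.ofReal b * μ E ≤ MAm U u F :=
    (hdoub E hEU hE hEb ⟨_, hcen⟩).trans
      ((measure_mono (image_mono subset_closure)).trans (hMA F (hFE.trans hEU) hFmeas))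
  have hbound : ∀ r : ℝ, 2 * M / (1 - c) < r →
      μ E * volume E ≤ ENNReal.ofReal (b⁻¹ * (D * r ^ n)) := by
    intro r hr
    have hr0 : 0 < r := lt_of_le_of_lt (by positivity) hr
    have h := (mul_le_mul_left hμ (volume E)).trans
      (MAm_mul_volume_le hc hEU hE hEb h0 hM hr0 hr.le)
    rw [ENNReal.ofReal_mul (by positivity), ENNReal.ofReal_inv_of_pos hb,
      ← ENNReal.div_eq_inv_mul, ENNReal.le_div_iff_mul_le
      (Or.inl (ENNReal.ofReal_pos.2 hb).ne') (Or.inl ENNReal.ofReal_ne_top), mul_comm, ← mul_assoc]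
    exact h
  have hlim : μ E * volume E ≤ ENNReal.ofReal (b⁻¹ * (D * (2 * M / (1 - c)) ^ n)) := by
    have hcts : Continuous fun r : ℝ => ENNReal.ofReal (b⁻¹ * (D * r ^ n)) :=
      ENNReal.continuous_ofReal.comp (by fun_prop)
    exact ge_of_tendsto (x := nhdsWithin _ (Ioi _))
      ((hcts.tendsto (2 * M / (1 - c))).mono_left nhdsWithin_le_nhds)
      (eventually_mem_nhdsWithin.mono hbound)
  refine hlim.trans (ENNReal.ofReal_le_ofReal ?_)
  have hsplit : (2 * M / (1 - c)) ^ n = (2 / (1 - c)) ^ n * M ^ n := by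
    rw [← mul_pow]; ring
  rw [hsplit, add_mul, one_mul]
  have : 0 ≤ M ^ n := by positivity
  linarith
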